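/- arXiv:1411.6149 — 2 statements merged into one kernel-verified Lean document; each statement's English description precedes it below -/
import Mathlib

section
/- Fix k = 2 and 0 ≤ β < 1. For each n, let Λ_n = dP_β/dP_0 be the Radon–Nikodym derivative of the law P_β of X = β v v^T + Z (v uniform on S^{n−1}, Z an independent n×n GOE matrix) with respect to the law P_0 of Z. Then limsup_{n→∞} E_0[Λ_n²] ≤ 1/√(1 − β²), where E_0 denotes expectation under P_0. -/
open MeasureTheory ProbabilityTheory Filter
open scoped ENNReal

noncomputable section

instance matrixMeasurableSpace {m n α : Type*} [MeasurableSpace α] :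
    MeasurableSpace (Matrix m n α) :=
  inferInstanceAs (MeasurableSpace (m → n → α))

/-- Product of i.i.d. standard Gaussians indexed by `ι`. -/
def stdGaussianPi (ι : Type*) [Fintype ι] : Measure (ι → ℝ) :=
  Measure.pi fun _ => gaussianReal 0 1

/-- GOE matrix law: `Z = (G + Gᵀ)/√(2n)` with `G` having i.i.d. `N(0,1)` entries; it is a
symmetric random matrix with independent upper-triangular entries `Z_ij ~ N(0,1/n)` for `i<j`
and `Z_ii ~ N(0,2/n)`. -/
def goe (n : ℕ) : Measure (Matrix (Fin n) (Fin n) ℝ) :=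
  (stdGaussianPi (Fin n × Fin n)).map
    fun g => Matrix.of fun i j => (g (i, j) + g (j, i)) / Real.sqrt (2 * n)

/-- The uniform (rotation-invariant) probability measure on the unit sphere `S^{n-1} ⊆ ℝⁿ`,
realized as the law of a normalized standard Gaussian vector. -/
def sphereUniform (n : ℕ) : Measure (EuclideanSpace ℝ (Fin n)) :=
  ((stdGaussianPi (Fin n)).map
      fun x => ((EuclideanSpace.equiv (Fin n) ℝ).symm x : EuclideanSpace ℝ (Fin n))).map
    fun v => ‖v‖⁻¹ • v

/-- Law of `β v vᵀ + Z` with `v` uniform on the unit sphere and `Z` an independent GOE matrix. -/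
def spikedGOE (n : ℕ) (β : ℝ) : Measure (Matrix (Fin n) (Fin n) ℝ) :=
  ((sphereUniform n).prod (goe n)).map
    fun p => Matrix.of fun i j => β * (p.1 i * p.1 j) + (p.2 : Matrix (Fin n) (Fin n) ℝ) i j

section Gaussian

variable {ι : Type*} [Fintype ι]

instance : IsProbabilityMeasure (stdGaussianPi ι) := by
  unfold stdGaussianPi; infer_instance

lemma lintegral_prod_stdGaussianPi (f : ι → ℝ → ℝ≥0∞) (hf : ∀ i, Measurable (f i)) :
    ∫⁻ x, ∏ i, f i (x i) ∂(stdGaussianPi ι) = ∏ i, ∫⁻ y, f i y ∂(gaussianReal 0 1) := by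
  unfold stdGaussianPi
  rw [lintegral_prod_eq_prod_lintegral_of_indepFun Finset.univ
    (fun i (x : ι → ℝ) => f i (x i)) (iIndepFun_pi fun i => (hf i).aemeasurable)
    (fun i => (hf i).comp (measurable_pi_apply i))]
  refine Finset.prod_congr rfl fun i _ => ?_
  exact (measurePreserving_eval (fun _ : ι => gaussianReal 0 1) i).lintegral_comp (hf i)

lemma gaussianReal_eq_withDensity_exp (h : ℝ) :
    gaussianReal h 1 = (gaussianReal 0 1).withDensity
      fun y => ENNReal.ofReal (Real.exp (h * y - h ^ 2 / 2)) := by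
  rw [gaussianReal_of_var_ne_zero _ one_ne_zero, gaussianReal_of_var_ne_zero _ one_ne_zero,
    ← withDensity_mul _ (measurable_gaussianPDF 0 1) (by fun_prop)]
  congr 1
  ext y
  simp only [Pi.mul_apply, gaussianPDF_def, gaussianPDFReal_def]
  rw [← ENNReal.ofReal_mul (by positivity), mul_assoc (Real.sqrt _)⁻¹, ← Real.exp_add]
  congr 3
  simp only [NNReal.coe_one]
  ring

/-- The Cameron–Martin formula for a standard Gaussian vector. -/
lemma map_add_stdGaussianPi (h : ι → ℝ) :
    (stdGaussianPi ι).map (fun g i => h i + g i) = (stdGaussianPi ι).withDensity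
      fun g => ENNReal.ofReal (Real.exp (∑ i, (h i * g i - h i ^ 2 / 2))) := by
  have hmap : (stdGaussianPi ι).map (fun g i => h i + g i)
      = Measure.pi fun i => gaussianReal (h i) 1 := by
    unfold stdGaussianPi
    rw [Measure.pi_map_pi (f := fun i (y : ℝ) => h i + y) (fun i => by fun_prop)]
    simp_rw [gaussianReal_map_const_add, zero_add]
  rw [hmap]
  refine Measure.pi_eq fun s hs => ?_
  rw [withDensity_apply _ (MeasurableSet.univ_pi hs), ← lintegral_indicator (.univ_pi hs)]
  simp_rw [gaussianReal_eq_withDensity_exp (h _), withDensity_apply _ (hs _),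
    ← lintegral_indicator (hs _)]
  rw [← lintegral_prod_stdGaussianPi]
  · refine lintegral_congr fun g => ?_
    by_cases hg : g ∈ Set.univ.pi s
    · rw [Set.indicator_of_mem hg, Real.exp_sum,
        ENNReal.ofReal_prod_of_nonneg fun _ _ => (Real.exp_pos _).le]
      exact Finset.prod_congr rfl fun i _ => by rw [Set.indicator_of_mem (hg i trivial)]
    · rw [Set.indicator_of_notMem hg]
      simp only [Set.mem_univ_pi, not_forall] at hg
      obtain ⟨i, hi⟩ := hg
      exact (Finset.prod_eq_zero (Finset.mem_univ i) (Set.indicator_of_notMem hi _)).symm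
  · intro i
    exact Measurable.indicator (by fun_prop) (hs i)

lemma lintegral_exp_stdGaussianPi (k : ι → ℝ) :
    ∫⁻ g, ENNReal.ofReal (Real.exp (∑ i, k i * g i)) ∂(stdGaussianPi ι)
      = ENNReal.ofReal (Real.exp (∑ i, k i ^ 2 / 2)) := by
  have h1 : ∫⁻ g, ENNReal.ofReal (Real.exp (∑ i, (k i * g i - k i ^ 2 / 2)))
      ∂(stdGaussianPi ι) = 1 := by
    rw [← setLIntegral_univ, ← withDensity_apply _ MeasurableSet.univ, ← map_add_stdGaussianPi,
      Measure.map_apply (by fun_prop) MeasurableSet.univ]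
    simp
  have h2 (g : ι → ℝ) : ENNReal.ofReal (Real.exp (∑ i, k i * g i))
      = ENNReal.ofReal (Real.exp (∑ i, k i ^ 2 / 2))
        * ENNReal.ofReal (Real.exp (∑ i, (k i * g i - k i ^ 2 / 2))) := by
    rw [← ENNReal.ofReal_mul (Real.exp_pos _).le, ← Real.exp_add, Finset.sum_sub_distrib]
    congr 2; ring
  simp_rw [h2]
  rw [lintegral_const_mul _ (by fun_prop), h1, mul_one]

lemma lintegral_exp_gaussianReal (t : ℝ) :
    ∫⁻ z, ENNReal.ofReal (Real.exp (t * z)) ∂(gaussianReal 0 1)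
      = ENNReal.ofReal (Real.exp (t ^ 2 / 2)) := by
  rw [← ofReal_integral_eq_lintegral_ofReal (integrable_exp_mul_gaussianReal t)
    (ae_of_all _ fun _ => (Real.exp_pos _).le)]
  have := congrFun (mgf_id_gaussianReal (μ := 0) (v := 1)) t
  simp only [mgf, id] at this
  rw [this]; simp

lemma lintegral_exp_sq_gaussianReal {b : ℝ} (hb : b < 1) :
    ∫⁻ z, ENNReal.ofReal (Real.exp (b * z ^ 2 / 2)) ∂(gaussianReal 0 1)
      = ENNReal.ofReal (1 / Real.sqrt (1 - b)) := by
  have hb' : 0 < (1 - b) / 2 := by linarith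
  rw [gaussianReal_of_var_ne_zero _ one_ne_zero,
    lintegral_withDensity_eq_lintegral_mul _ (measurable_gaussianPDF 0 1) (by fun_prop)]
  have h (z : ℝ) : (gaussianPDF 0 1 * fun z => ENNReal.ofReal (Real.exp (b * z ^ 2 / 2))) z
      = ENNReal.ofReal ((Real.sqrt (2 * Real.pi))⁻¹ * Real.exp (-((1 - b) / 2) * z ^ 2)) := by
    simp only [Pi.mul_apply, gaussianPDF_def, gaussianPDFReal_def]
    rw [← ENNReal.ofReal_mul (by positivity), mul_assoc, ← Real.exp_add]
    congr 3
    · simp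
    · simp only [NNReal.coe_one]
      ring_nf
  simp_rw [h]
  rw [← ofReal_integral_eq_lintegral_ofReal ((integrable_exp_neg_mul_sq hb').const_mul _)
    (ae_of_all _ fun _ => by positivity), integral_const_mul, integral_gaussian]
  congr 1
  rw [← Real.sqrt_inv, ← Real.sqrt_mul (by positivity), one_div, ← Real.sqrt_inv]
  congr 1
  have : 1 - b ≠ 0 := by linarith
  field_simp

lemma exp_le_lintegral_exp_sq_gaussianReal (a : ℝ) :
    ENNReal.ofReal (Real.exp a) ≤ ∫⁻ z, ENNReal.ofReal (Real.exp (a * z ^ 2))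
      ∂(gaussianReal 0 1) := by
  have hsq : Integrable (fun z : ℝ => z ^ 2) (gaussianReal 0 1) :=
    (memLp_id_gaussianReal 2).integrable_sq
  have hval : ∫ z, z ^ 2 ∂(gaussianReal 0 1) = 1 := by
    have := variance_of_integral_eq_zero (X := id) (μ := gaussianReal 0 1) aemeasurable_id
      (by simp [integral_id_gaussianReal])
    rw [variance_id_gaussianReal] at this
    simpa using this.symm
  have hsub : Integrable (fun z : ℝ => a * (z ^ 2 - 1)) (gaussianReal 0 1) :=
    (hsq.sub (integrable_const _)).const_mul _
  have hint : Integrable (fun z : ℝ => Real.exp a * (1 + a * (z ^ 2 - 1))) (gaussianReal 0 1) :=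
    ((integrable_const _).add hsub).const_mul _
  calc ENNReal.ofReal (Real.exp a)
      = ENNReal.ofReal (∫ z, Real.exp a * (1 + a * (z ^ 2 - 1)) ∂(gaussianReal 0 1)) := by
        rw [integral_const_mul, integral_add (integrable_const _) hsub, integral_const_mul,
          integral_sub hsq (integrable_const _), hval]
        simp
    _ ≤ ∫⁻ z, ENNReal.ofReal (Real.exp a * (1 + a * (z ^ 2 - 1))) ∂(gaussianReal 0 1) :=
        (ENNReal.ofReal_le_ofReal (integral_mono hint hint.pos_part fun _ => le_max_left _ _)).trans
          (by rw [ofReal_integral_eq_lintegral_ofReal hint.pos_part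
                (ae_of_all _ fun _ => le_max_right _ _)]
              simp [ENNReal.ofReal_max])
    _ ≤ _ := by
        refine lintegral_mono fun z => ENNReal.ofReal_le_ofReal ?_
        have h1 := Real.add_one_le_exp (a * (z ^ 2 - 1))
        calc Real.exp a * (1 + a * (z ^ 2 - 1)) ≤ Real.exp a * Real.exp (a * (z ^ 2 - 1)) := by
              gcongr; linarith
          _ = _ := by rw [← Real.exp_add]; congr 1; ring

lemma exp_card_le_lintegral_exp_sum_sq (a : ℝ) :
    ENNReal.ofReal (Real.exp (Fintype.card ι * a)) ≤
      ∫⁻ x, ENNReal.ofReal (Real.exp (a * ∑ i, x i ^ 2)) ∂(stdGaussianPi ι) := by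
  have h (x : ι → ℝ) : ENNReal.ofReal (Real.exp (a * ∑ i, x i ^ 2))
      = ∏ i, ENNReal.ofReal (Real.exp (a * x i ^ 2)) := by
    rw [Finset.mul_sum, Real.exp_sum,
      ENNReal.ofReal_prod_of_nonneg fun _ _ => (Real.exp_pos _).le]
  simp_rw [h]
  rw [lintegral_prod_stdGaussianPi (fun _ y => ENNReal.ofReal (Real.exp (a * y ^ 2)))
    (fun _ => by fun_prop), Finset.prod_const, Finset.card_univ, Real.exp_nat_mul,
    ENNReal.ofReal_pow (Real.exp_pos _).le]
  gcongr
  exact exp_le_lintegral_exp_sq_gaussianReal a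

end Gaussian

section Mixture

variable {G V S : Type*} [MeasurableSpace G] [MeasurableSpace V] [MeasurableSpace S]

lemma map_map_eq_withDensity_of_semiconj {γ : Measure G} {T : G → S} {f : G → G} {A : S → S}
    {D : S → ℝ≥0∞} (hT : Measurable T) (hf : Measurable f) (hA : Measurable A) (hD : Measurable D)
    (hcomm : ∀ g, A (T g) = T (f g)) (hdens : γ.map f = γ.withDensity fun g => D (T g)) :
    (γ.map T).map A = (γ.map T).withDensity D := by
  refine Measure.ext_of_lintegral _ fun φ hφ => ?_
  rw [lintegral_map hφ hA, lintegral_withDensity_eq_lintegral_mul _ hD hφ,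
    lintegral_map (f := fun x => φ (A x)) (hφ.comp hA) hT, lintegral_map (hD.mul hφ) hT]
  simp only [hcomm]
  rw [← lintegral_map (f := fun g => φ (T g)) (hφ.comp hT) hf, hdens,
    lintegral_withDensity_eq_lintegral_mul _ (f := fun g => D (T g)) (hD.comp hT)
      (g := fun g => φ (T g)) (hφ.comp hT)]
  rfl

variable {σ : Measure V} {μ : Measure S} [SFinite σ] {D : V → S → ℝ≥0∞}

lemma map_prod_eq_withDensity_lintegral [SFinite μ] {T : V × S → S} (hT : Measurable T)
    (hD : Measurable (Function.uncurry D))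
    (hdens : ∀ v, μ.map (fun x => T (v, x)) = μ.withDensity (D v)) :
    (σ.prod μ).map T = μ.withDensity fun x => ∫⁻ v, D v x ∂σ := by
  refine Measure.ext_of_lintegral _ fun f hf => ?_
  rw [lintegral_map hf hT, lintegral_prod (fun p => f (T p)) (hf.comp hT).aemeasurable,
    lintegral_withDensity_eq_lintegral_mul _ (f := fun x => ∫⁻ v, D v x ∂σ)
      hD.lintegral_prod_left' hf]
  calc _ = ∫⁻ v, ∫⁻ x, D v x * f x ∂μ ∂σ := by
        refine lintegral_congr fun v => ?_
        rw [← lintegral_map (g := fun x => T (v, x)) hf (hT.comp measurable_prodMk_left), hdens,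
          lintegral_withDensity_eq_lintegral_mul _ (Measurable.of_uncurry_left hD) hf]
        rfl
    _ = ∫⁻ x, ∫⁻ v, D v x * f x ∂σ ∂μ :=
        lintegral_lintegral_swap (hD.mul (hf.comp measurable_snd)).aemeasurable
    _ = _ := by
        refine lintegral_congr fun x => ?_
        rw [lintegral_mul_const _ (Measurable.of_uncurry_right hD)]
        rfl

lemma lintegral_rnDeriv_mixture_sq [SigmaFinite μ] (hD : Measurable (Function.uncurry D)) :
    ∫⁻ x, ((μ.withDensity fun x => ∫⁻ v, D v x ∂σ).rnDeriv μ x) ^ 2 ∂μ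
      = ∫⁻ v, ∫⁻ w, ∫⁻ x, D v x * D w x ∂μ ∂σ ∂σ := by
  have hDw (x) : Measurable fun v => D v x := Measurable.of_uncurry_right hD
  have hL : Measurable fun x => ∫⁻ v, D v x ∂σ := hD.lintegral_prod_left'
  have hswap : Measurable fun p : S × V => D p.2 p.1 := hD.comp measurable_swap
  calc _ = ∫⁻ x, (∫⁻ v, D v x ∂σ) ^ 2 ∂μ := by
        refine lintegral_congr_ae ?_
        filter_upwards [Measure.rnDeriv_withDensity μ hL] with x hx
        rw [hx]
    _ = ∫⁻ x, ∫⁻ v, D v x * ∫⁻ w, D w x ∂σ ∂σ ∂μ := by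
        refine lintegral_congr fun x => ?_
        rw [lintegral_mul_const _ (hDw x), sq]
    _ = ∫⁻ v, ∫⁻ x, D v x * ∫⁻ w, D w x ∂σ ∂μ ∂σ :=
        lintegral_lintegral_swap (hswap.mul (hL.comp measurable_fst)).aemeasurable
    _ = ∫⁻ v, ∫⁻ x, ∫⁻ w, D v x * D w x ∂σ ∂μ ∂σ := by
        simp_rw [lintegral_const_mul _ (hDw _)]
    _ = _ := lintegral_congr fun v => lintegral_lintegral_swap
          ((hD.comp (measurable_const.prodMk measurable_fst)).mul hswap).aemeasurable

end Mixture

section GOE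

variable {n : ℕ}

/-- The linear map sending a Gaussian array to a GOE matrix. -/
def symmetrize (n : ℕ) (g : Fin n × Fin n → ℝ) : Matrix (Fin n) (Fin n) ℝ :=
  Matrix.of fun i j => (g (i, j) + g (j, i)) / Real.sqrt (2 * n)

/-- The spiked matrix `β v vᵀ + X`. -/
def addSpike (β : ℝ) (p : EuclideanSpace ℝ (Fin n) × Matrix (Fin n) (Fin n) ℝ) :
    Matrix (Fin n) (Fin n) ℝ :=
  Matrix.of fun i j => β * (p.1 i * p.1 j) + (p.2 : Matrix (Fin n) (Fin n) ℝ) i j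

/-- The shift of the Gaussian array producing the spike `β v vᵀ`. -/
def spikeShift (β : ℝ) (v : EuclideanSpace ℝ (Fin n)) (p : Fin n × Fin n) : ℝ :=
  β * Real.sqrt (2 * n) / 2 * (v p.1 * v p.2)

/-- The likelihood ratio of `β v vᵀ + Z` with respect to `Z`, for a fixed vector `v`. -/
def spikeDensity (β : ℝ) (v : EuclideanSpace ℝ (Fin n)) (X : Matrix (Fin n) (Fin n) ℝ) : ℝ≥0∞ :=
  ENNReal.ofReal (Real.exp (n * β / 2 * ∑ p : Fin n × Fin n, v p.1 * v p.2 * X p.1 p.2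
    - ∑ p, spikeShift β v p ^ 2 / 2))

lemma measurable_matrix_apply (i j : Fin n) :
    Measurable fun X : Matrix (Fin n) (Fin n) ℝ => X i j :=
  (measurable_pi_apply j).comp (measurable_pi_apply i)

lemma measurable_snd_apply (i j : Fin n) :
    Measurable fun p : EuclideanSpace ℝ (Fin n) × Matrix (Fin n) (Fin n) ℝ =>
      (p.2 : Matrix (Fin n) (Fin n) ℝ) i j :=
  (measurable_matrix_apply i j).comp measurable_snd

lemma measurable_matrix_of {α : Type*} [MeasurableSpace α] {f : α → Fin n → Fin n → ℝ}
    (hf : ∀ i j, Measurable fun a => f a i j) : Measurable fun a => Matrix.of (f a) :=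
  measurable_pi_lambda _ fun i => measurable_pi_lambda _ fun j => hf i j

lemma measurable_symmetrize : Measurable (symmetrize n) :=
  measurable_matrix_of fun i j => by fun_prop

lemma measurable_addSpike (β : ℝ) : Measurable (addSpike (n := n) β) :=
  measurable_matrix_of fun i j => by
    have := measurable_snd_apply i j
    fun_prop

lemma measurable_spikeDensity (β : ℝ) :
    Measurable (Function.uncurry (spikeDensity (n := n) β)) := by
  have (p : Fin n × Fin n) := measurable_snd_apply p.1 p.2
  unfold spikeDensity spikeShift Function.uncurry
  fun_prop

instance : IsProbabilityMeasure (goe n) :=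
  Measure.isProbabilityMeasure_map (measurable_symmetrize (n := n)).aemeasurable

lemma spikeDensity_symmetrize (hn : n ≠ 0) (β : ℝ) (v : EuclideanSpace ℝ (Fin n))
    (g : Fin n × Fin n → ℝ) :
    spikeDensity β v (symmetrize n g) = ENNReal.ofReal (Real.exp
      (∑ p, (spikeShift β v p * g p - spikeShift β v p ^ 2 / 2))) := by
  unfold spikeDensity
  rw [Finset.sum_sub_distrib]
  congr 3
  have hs : Real.sqrt (2 * n) * Real.sqrt (2 * n) = 2 * n := Real.mul_self_sqrt (by positivity)
  have hs0 : Real.sqrt (2 * n) ≠ 0 := by positivity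
  have hswap : ∑ p : Fin n × Fin n, v p.1 * v p.2 * g (p.2, p.1) = ∑ p, v p.1 * v p.2 * g p :=
    Fintype.sum_equiv (Equiv.prodComm _ _) _ _ fun p => by
      rw [mul_comm (v p.1)]; rfl
  have hsum : ∑ p : Fin n × Fin n, v p.1 * v p.2 * symmetrize n g p.1 p.2
      = 2 / Real.sqrt (2 * n) * ∑ p, v p.1 * v p.2 * g p := by
    calc _ = (∑ p : Fin n × Fin n, v p.1 * v p.2 * g p
        + ∑ p : Fin n × Fin n, v p.1 * v p.2 * g (p.2, p.1)) / Real.sqrt (2 * n) := by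
          rw [← Finset.sum_add_distrib, Finset.sum_div]
          refine Finset.sum_congr rfl fun p _ => ?_
          simp only [symmetrize, Matrix.of_apply]
          ring
      _ = _ := by rw [hswap]; ring
  rw [hsum]
  simp only [spikeShift]
  simp_rw [mul_assoc (β * Real.sqrt (2 * n) / 2), ← Finset.mul_sum]
  have hc : n * β / 2 * (2 / Real.sqrt (2 * n)) = β * Real.sqrt (2 * n) / 2 := by
    rw [← mul_div_assoc, div_eq_iff hs0]
    linear_combination -β / 2 * hs
  rw [← mul_assoc, hc]

lemma map_addSpike_goe (hn : n ≠ 0) (β : ℝ) (v : EuclideanSpace ℝ (Fin n)) :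
    (goe n).map (fun X => addSpike β (v, X)) = (goe n).withDensity (spikeDensity β v) := by
  have hs : Real.sqrt (2 * n) ≠ 0 := by positivity
  refine map_map_eq_withDensity_of_semiconj (γ := stdGaussianPi (Fin n × Fin n))
    (T := symmetrize n)
    (f := fun g p => spikeShift β v p + g p) measurable_symmetrize (by fun_prop)
    ((measurable_addSpike β).comp measurable_prodMk_left)
    (Measurable.of_uncurry_left (measurable_spikeDensity β)) (fun g => ?_) ?_
  · ext i j
    simp only [addSpike, symmetrize, spikeShift, Matrix.of_apply]
    field_simp
    ring
  · rw [map_add_stdGaussianPi]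
    simp_rw [spikeDensity_symmetrize hn]

lemma lintegral_spikeDensity_mul (hn : n ≠ 0) (β : ℝ) (v w : EuclideanSpace ℝ (Fin n)) :
    ∫⁻ X, spikeDensity β v X * spikeDensity β w X ∂(goe n)
      = ENNReal.ofReal (Real.exp (β ^ 2 / 2 * (n * (∑ i, v i * w i) ^ 2))) := by
  have hD (u : EuclideanSpace ℝ (Fin n)) : Measurable (spikeDensity β u) :=
    Measurable.of_uncurry_left (measurable_spikeDensity β)
  have h (g : Fin n × Fin n → ℝ) :
      spikeDensity β v (symmetrize n g) * spikeDensity β w (symmetrize n g)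
      = ENNReal.ofReal (Real.exp (-∑ p, (spikeShift β v p ^ 2 + spikeShift β w p ^ 2) / 2))
        * ENNReal.ofReal (Real.exp (∑ p, (spikeShift β v p + spikeShift β w p) * g p)) := by
    rw [spikeDensity_symmetrize hn, spikeDensity_symmetrize hn,
      ← ENNReal.ofReal_mul (Real.exp_pos _).le, ← ENNReal.ofReal_mul (Real.exp_pos _).le,
      ← Real.exp_add, ← Real.exp_add, ← Finset.sum_neg_distrib, ← Finset.sum_add_distrib,
      ← Finset.sum_add_distrib]
    congr 3; ext p; ring
  have hs : Real.sqrt (2 * n) * Real.sqrt (2 * n) = 2 * n := Real.mul_self_sqrt (by positivity)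
  calc _ = ∫⁻ g, spikeDensity β v (symmetrize n g) * spikeDensity β w (symmetrize n g)
        ∂(stdGaussianPi (Fin n × Fin n)) :=
        lintegral_map (f := fun X => spikeDensity β v X * spikeDensity β w X)
          ((hD v).mul (hD w)) measurable_symmetrize
    _ = ENNReal.ofReal (Real.exp (∑ p : Fin n × Fin n,
          β ^ 2 / 2 * n * ((v p.1 * w p.1) * (v p.2 * w p.2)))) := by
        simp_rw [h]
        rw [lintegral_const_mul _ (by fun_prop), lintegral_exp_stdGaussianPi,
          ← ENNReal.ofReal_mul (Real.exp_pos _).le, ← Real.exp_add, ← Finset.sum_neg_distrib,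
          ← Finset.sum_add_distrib]
        congr 2
        refine Finset.sum_congr rfl fun p _ => ?_
        simp only [spikeShift]
        linear_combination β ^ 2 / 4 * ((v p.1 * w p.1) * (v p.2 * w p.2)) * hs
    _ = _ := by
        rw [← Finset.mul_sum, Fintype.sum_prod_type,
          ← Finset.sum_mul_sum Finset.univ Finset.univ (fun i => v i * w i) fun i => v i * w i]
        congr 2
        ring

end GOE

section Sphere

variable {n : ℕ}

lemma sphereUniform_eq_map_stdGaussian :
    sphereUniform n = (stdGaussian (EuclideanSpace ℝ (Fin n))).map fun v => ‖v‖⁻¹ • v := by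
  rw [← map_pi_eq_stdGaussian]
  rfl

instance : IsProbabilityMeasure (sphereUniform n) := by
  rw [sphereUniform_eq_map_stdGaussian]
  exact Measure.isProbabilityMeasure_map (by fun_prop)

lemma sphereUniform_map_isometry
    (U : EuclideanSpace ℝ (Fin n) ≃ₗᵢ[ℝ] EuclideanSpace ℝ (Fin n)) :
    (sphereUniform n).map U = sphereUniform n := by
  rw [sphereUniform_eq_map_stdGaussian, Measure.map_map (by fun_prop) (by fun_prop)]
  conv_rhs => rw [← stdGaussian_map U, Measure.map_map (by fun_prop) (by fun_prop)]
  congr 1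
  ext1 v
  simp

lemma ae_norm_le_one_sphereUniform : ∀ᵐ v ∂(sphereUniform n), ‖v‖ ≤ 1 := by
  rw [sphereUniform_eq_map_stdGaussian,
    ae_map_iff (by fun_prop) (measurableSet_le (by fun_prop) (by fun_prop))]
  refine ae_of_all _ fun v => ?_
  rw [norm_smul, norm_inv, norm_norm]
  exact inv_mul_le_one

/-- By rotation invariance, integrals of functions of `⟪x, v⟫` over the sphere depend on `x`
only through its norm. -/
lemma lintegral_sphereUniform_inner_eq_of_norm_eq {f : ℝ → ℝ≥0∞} (hf : Measurable f)
    {x y : EuclideanSpace ℝ (Fin n)} (h : ‖x‖ = ‖y‖) :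
    ∫⁻ v, f (inner ℝ x v) ∂(sphereUniform n) = ∫⁻ v, f (inner ℝ y v) ∂(sphereUniform n) := by
  obtain ⟨U, rfl⟩ : ∃ U : EuclideanSpace ℝ (Fin n) ≃ₗᵢ[ℝ] EuclideanSpace ℝ (Fin n), U x = y :=
    ⟨_, Submodule.reflection_sub h⟩
  conv_rhs => rw [← sphereUniform_map_isometry U]
  rw [lintegral_map (by fun_prop) (by fun_prop)]
  simp

lemma lintegral_exp_inner_stdGaussian (v : EuclideanSpace ℝ (Fin n)) :
    ∫⁻ x, ENNReal.ofReal (Real.exp (inner ℝ x v)) ∂(stdGaussian (EuclideanSpace ℝ (Fin n)))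
      = ENNReal.ofReal (Real.exp (‖v‖ ^ 2 / 2)) := by
  rw [← map_pi_eq_stdGaussian, lintegral_map (by fun_prop) (by fun_prop)]
  have := lintegral_exp_stdGaussianPi fun i => v i
  rw [← Finset.sum_div, ← EuclideanSpace.real_norm_sq_eq] at this
  rw [← this]
  rfl

lemma lintegral_exp_inner_sq_stdGaussian_le {b : ℝ} (hb0 : 0 ≤ b) (hb : b < 1)
    {v : EuclideanSpace ℝ (Fin n)} (hv : ‖v‖ ≤ 1) :
    ∫⁻ x, ENNReal.ofReal (Real.exp (b / 2 * (inner ℝ x v) ^ 2))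
      ∂(stdGaussian (EuclideanSpace ℝ (Fin n))) ≤ ENNReal.ofReal (1 / Real.sqrt (1 - b)) := by
  have hsq : Real.sqrt b ^ 2 = b := Real.sq_sqrt hb0
  calc _ = ∫⁻ x, ∫⁻ z, ENNReal.ofReal (Real.exp (inner ℝ x ((Real.sqrt b * z) • v)))
        ∂(gaussianReal 0 1) ∂(stdGaussian (EuclideanSpace ℝ (Fin n))) := by
        refine lintegral_congr fun x => ?_
        have := lintegral_exp_gaussianReal (Real.sqrt b * inner ℝ x v)
        rw [mul_pow, hsq, mul_div_right_comm] at this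
        rw [← this]
        refine lintegral_congr fun z => ?_
        rw [real_inner_smul_right]
        congr 2; ring
    _ = ∫⁻ z, ∫⁻ x, ENNReal.ofReal (Real.exp (inner ℝ x ((Real.sqrt b * z) • v)))
        ∂(stdGaussian (EuclideanSpace ℝ (Fin n))) ∂(gaussianReal 0 1) :=
        lintegral_lintegral_swap (by fun_prop)
    _ ≤ ∫⁻ z, ENNReal.ofReal (Real.exp (b * z ^ 2 / 2)) ∂(gaussianReal 0 1) := by
        refine lintegral_mono fun z => ?_
        rw [lintegral_exp_inner_stdGaussian, norm_smul, mul_pow, Real.norm_eq_abs, sq_abs, mul_pow,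
          hsq]
        refine ENNReal.ofReal_le_ofReal (Real.exp_le_exp.2 (div_le_div_of_nonneg_right ?_ two_pos.le))
        exact mul_le_of_le_one_right (by positivity) (pow_le_one₀ (norm_nonneg _) hv)
    _ = _ := lintegral_exp_sq_gaussianReal hb

lemma lintegral_sphereUniform_exp_inner_sq_le {b : ℝ} (hb0 : 0 ≤ b) (hb : b < 1)
    {w : EuclideanSpace ℝ (Fin n)} (hw : ‖w‖ ≤ 1) :
    ∫⁻ v, ENNReal.ofReal (Real.exp (b / 2 * (n * (inner ℝ w v) ^ 2))) ∂(sphereUniform n)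
      ≤ ENNReal.ofReal (1 / Real.sqrt (1 - b)) := by
  rcases isEmpty_or_nonempty (Fin n) with hE | ⟨⟨i⟩⟩
  · have : (n : ℝ) = 0 := by
      rw [← Fintype.card_fin n, Fintype.card_eq_zero_iff.2 hE, Nat.cast_zero]
    simp only [this, zero_mul, mul_zero, Real.exp_zero, ENNReal.ofReal_one, lintegral_const,
      measure_univ, mul_one]
    rw [ENNReal.one_le_ofReal, one_le_div (Real.sqrt_pos.2 (by linarith)), Real.sqrt_le_one]
    linarith
  set e : EuclideanSpace ℝ (Fin n) := EuclideanSpace.single i 1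
  have he : ‖e‖ = 1 := by simp [e]
  have hnorm (x : EuclideanSpace ℝ (Fin n)) (c : ℝ) :
      ∫⁻ v, ENNReal.ofReal (Real.exp (c * (inner ℝ x v) ^ 2)) ∂(sphereUniform n)
      = ∫⁻ v, ENNReal.ofReal (Real.exp (c * (inner ℝ e v) ^ 2 * ‖x‖ ^ 2))
        ∂(sphereUniform n) := by
    rw [lintegral_sphereUniform_inner_eq_of_norm_eq
      (f := fun t => ENNReal.ofReal (Real.exp (c * t ^ 2))) (by fun_prop)
      (show ‖x‖ = ‖‖x‖ • e‖ by simp [norm_smul, he])]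
    refine lintegral_congr fun v => ?_
    rw [real_inner_smul_left]
    congr 2; ring
  calc _ ≤ ∫⁻ v, ENNReal.ofReal (Real.exp (n * (b / 2 * (inner ℝ e v) ^ 2)))
          ∂(sphereUniform n) := by
        simp_rw [← mul_assoc (b / 2)]
        rw [hnorm w]
        refine lintegral_mono fun v => ENNReal.ofReal_le_ofReal (Real.exp_le_exp.2 ?_)
        calc _ ≤ b / 2 * n * (inner ℝ e v) ^ 2 :=
              mul_le_of_le_one_right (by positivity) (pow_le_one₀ (norm_nonneg _) hw)
          _ = _ := by ring
    _ ≤ ∫⁻ v, ∫⁻ x, ENNReal.ofReal (Real.exp (b / 2 * (inner ℝ e v) ^ 2 * ‖x‖ ^ 2))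
          ∂(stdGaussian (EuclideanSpace ℝ (Fin n))) ∂(sphereUniform n) := by
        refine lintegral_mono fun v => ?_
        rw [← map_pi_eq_stdGaussian, lintegral_map (by fun_prop) (by fun_prop)]
        simp_rw [EuclideanSpace.real_norm_sq_eq]
        have := exp_card_le_lintegral_exp_sum_sq (ι := Fin n) (b / 2 * (inner ℝ e v) ^ 2)
        rwa [Fintype.card_fin] at this
    _ = ∫⁻ x, ∫⁻ v, ENNReal.ofReal (Real.exp (b / 2 * (inner ℝ e v) ^ 2 * ‖x‖ ^ 2))
          ∂(sphereUniform n) ∂(stdGaussian (EuclideanSpace ℝ (Fin n))) :=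
        lintegral_lintegral_swap (by fun_prop)
    _ = ∫⁻ x, ∫⁻ v, ENNReal.ofReal (Real.exp (b / 2 * (inner ℝ x v) ^ 2))
          ∂(sphereUniform n) ∂(stdGaussian (EuclideanSpace ℝ (Fin n))) := by
        simp_rw [← hnorm]
    _ = ∫⁻ v, ∫⁻ x, ENNReal.ofReal (Real.exp (b / 2 * (inner ℝ x v) ^ 2))
          ∂(stdGaussian (EuclideanSpace ℝ (Fin n))) ∂(sphereUniform n) :=
        lintegral_lintegral_swap (by fun_prop)
    _ ≤ ∫⁻ _, ENNReal.ofReal (1 / Real.sqrt (1 - b)) ∂(sphereUniform n) := by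
        refine lintegral_mono_ae ?_
        filter_upwards [ae_norm_le_one_sphereUniform] with v hv
        exact lintegral_exp_inner_sq_stdGaussian_le hb0 hb hv
    _ = _ := by simp

end Sphere

/-- The second moment of the likelihood ratio is an exponential moment of the squared overlap of
two independent spikes. -/
lemma lintegral_rnDeriv_spikedGOE_sq {n : ℕ} (hn : n ≠ 0) (β : ℝ) :
    ∫⁻ X, ((spikedGOE n β).rnDeriv (goe n) X) ^ 2 ∂(goe n)
      = ∫⁻ v, ∫⁻ w, ENNReal.ofReal (Real.exp (β ^ 2 / 2 * (n * (∑ i, v i * w i) ^ 2)))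
        ∂(sphereUniform n) ∂(sphereUniform n) := by
  have h : spikedGOE n β = (goe n).withDensity
      fun X => ∫⁻ v, spikeDensity β v X ∂(sphereUniform n) :=
    map_prod_eq_withDensity_lintegral (measurable_addSpike β) (measurable_spikeDensity β)
      (map_addSpike_goe hn β)
  rw [h, lintegral_rnDeriv_mixture_sq (measurable_spikeDensity β)]
  simp_rw [lintegral_spikeDensity_mul hn]

/-- for `k = 2` (spiked GOE) and `0 ≤ β < 1`, the second moments `E_0[Λ_n²]` of
the Radon–Nikodym derivatives `Λ_n = dP_β/dP_0` satisfy `limsup E_0[Λ_n²] ≤ 1/√(1−β²)`. -/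
theorem goe_second_moment_limsup
    (β : ℝ) (hβ0 : 0 ≤ β) (hβ : β < 1) :
    limsup (fun n => ∫⁻ x, ((spikedGOE n β).rnDeriv (goe n) x) ^ 2 ∂(goe n)) atTop
      ≤ ENNReal.ofReal (1 / Real.sqrt (1 - β ^ 2)) := by
  refine limsup_le_of_le (by isBoundedDefault) ?_
  filter_upwards [eventually_ne_atTop 0] with n hn
  rw [lintegral_rnDeriv_spikedGOE_sq hn]
  calc _ ≤ ∫⁻ _, ENNReal.ofReal (1 / Real.sqrt (1 - β ^ 2)) ∂(sphereUniform n) := by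
        refine lintegral_mono_ae ?_
        filter_upwards [ae_norm_le_one_sphereUniform] with v hv
        have := lintegral_sphereUniform_exp_inner_sq_le (sq_nonneg β)
          (pow_lt_one₀ hβ0 hβ two_ne_zero) hv
        simpa [PiLp.inner_apply, mul_comm] using this
    _ = _ := by simp


end
end

section
/- For k = 2 and any fixed λ with 0 ≤ λ < 1, the sequence of laws P_λ of the random matrix X = λ v₁ v₂^T + Z (where v₁, v₂ are independent uniform vectors on S^{n−1} and Z is an independent n×n random matrix with i.i.d. N(0,1/n) entries) is contiguous with respect to the sequence P_0 of laws of Z: for any sequence of measurable sets A_n of n×n matrices, P_0(A_n) → 0 implies P_λ(A_n) → 0 as n → ∞. -/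
open MeasureTheory ProbabilityTheory Filter
open scoped ENNReal

noncomputable section

/-- Random matrix with i.i.d. `N(0,1/n)` entries. -/
def ginibre (n : ℕ) : Measure (Matrix (Fin n) (Fin n) ℝ) :=
  (stdGaussianPi (Fin n × Fin n)).map fun g => Matrix.of fun i j => g (i, j) / Real.sqrt n

/-- Law of `λ v₁ v₂ᵀ + Z` with `v₁, v₂` independent uniform on the sphere and `Z` an
independent matrix with i.i.d. `N(0,1/n)` entries. -/
def spikedGinibre (n : ℕ) (lam : ℝ) : Measure (Matrix (Fin n) (Fin n) ℝ) :=
  (((sphereUniform n).prod (sphereUniform n)).prod (ginibre n)).map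
    fun p => Matrix.of fun i j =>
      lam * (p.1.1 i * p.1.2 j) + (p.2 : Matrix (Fin n) (Fin n) ℝ) i j

theorem pi_withDensity {ι : Type*} [Fintype ι] (μ : ι → Measure ℝ)
    [∀ i, IsProbabilityMeasure (μ i)] (f : ι → ℝ → ℝ≥0∞) (hf : ∀ i, Measurable (f i))
    [∀ i, SigmaFinite ((μ i).withDensity (f i))] :
    Measure.pi (fun i => (μ i).withDensity (f i)) =
      (Measure.pi μ).withDensity fun x => ∏ i, f i (x i) := by
  refine Measure.pi_eq fun s hs => ?_
  rw [withDensity_apply _ (MeasurableSet.univ_pi hs),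
    ← lintegral_indicator (MeasurableSet.univ_pi hs)]
  have hprod : (Set.univ.pi s).indicator (fun x => ∏ i, f i (x i)) =
      fun x => ∏ i, (s i).indicator (f i) (x i) := by
    ext x
    by_cases hx : x ∈ Set.univ.pi s
    · rw [Set.indicator_of_mem hx]
      exact Finset.prod_congr rfl fun i _ => (Set.indicator_of_mem (hx i trivial) _).symm
    · rw [Set.indicator_of_notMem hx]
      simp only [Set.mem_pi, Set.mem_univ, true_imp_iff, not_forall] at hx
      obtain ⟨i, hi⟩ := hx
      exact (Finset.prod_eq_zero (Finset.mem_univ i) (Set.indicator_of_notMem hi _)).symm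
  have hmeas : ∀ i, Measurable ((s i).indicator (f i)) := fun i => (hf i).indicator (hs i)
  rw [hprod]
  have hind := iIndepFun_pi (μ := μ) (X := fun i => (s i).indicator (f i))
    fun i => (hmeas i).aemeasurable
  rw [lintegral_prod_eq_prod_lintegral_of_indepFun Finset.univ
    (fun i (x : ι → ℝ) => (s i).indicator (f i) (x i)) hind
    fun i => (hmeas i).comp (measurable_pi_apply i)]
  refine Finset.prod_congr rfl fun i _ => ?_
  rw [withDensity_apply _ (hs i), ← lintegral_indicator (hs i),
    ← (measurePreserving_eval μ i).lintegral_comp (hmeas i)]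

theorem gaussianReal_eq_withDensity (μ : ℝ) {v : NNReal} (hv : v ≠ 0) :
    gaussianReal μ v = (gaussianReal 0 1).withDensity
      fun x => ENNReal.ofReal (gaussianPDFReal μ v x / gaussianPDFReal 0 1 x) := by
  rw [gaussianReal_of_var_ne_zero _ hv, gaussianReal_of_var_ne_zero _ one_ne_zero,
    ← withDensity_mul _ (measurable_gaussianPDF 0 1) (by fun_prop)]
  congr 1
  ext x
  have h := gaussianPDFReal_pos 0 1 x one_ne_zero
  rw [Pi.mul_apply, gaussianPDF, gaussianPDF, ← ENNReal.ofReal_mul h.le, mul_div_cancel₀ _ h.ne']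

theorem gaussianReal_shift_eq_withDensity (m : ℝ) :
    gaussianReal m 1 = (gaussianReal 0 1).withDensity
      fun x => ENNReal.ofReal (Real.exp (m * x - m ^ 2 / 2)) := by
  rw [gaussianReal_eq_withDensity m one_ne_zero]
  congr 1
  ext x
  simp only [gaussianPDFReal, NNReal.coe_one]
  rw [mul_div_mul_left _ _ (by positivity), ← Real.exp_sub]
  congr 2
  ring

theorem gaussianReal_scale_eq_withDensity {c : ℝ} (hc : 0 < c) :
    (gaussianReal 0 1).map (c⁻¹ * ·) = (gaussianReal 0 1).withDensity
      fun x => ENNReal.ofReal (c * Real.exp (-((c ^ 2 - 1) / 2 * x ^ 2))) := by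
  rw [gaussianReal_map_const_mul, gaussianReal_eq_withDensity _
    (by rw [← NNReal.coe_ne_zero]; simp [hc.ne'])]
  congr 1
  ext x
  simp only [gaussianPDFReal, NNReal.coe_one, NNReal.coe_mk, mul_one, mul_zero,
    sub_zero]
  congr 1
  rw [mul_div_mul_comm, ← Real.exp_sub, Real.sqrt_mul (by positivity), Real.sqrt_sq (by positivity)]
  congr 1
  · field_simp
  · congr 1
    field_simp
    ring

instance isProbabilityMeasure_stdGaussianPi (ι : Type*) [Fintype ι] :
    IsProbabilityMeasure (stdGaussianPi ι) := by
  unfold stdGaussianPi; infer_instance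

/-- The density of a standard Gaussian vector shifted by `m`. -/
def shiftDensity {ι : Type*} [Fintype ι] (m x : ι → ℝ) : ℝ≥0∞ :=
  ENNReal.ofReal (Real.exp (∑ i, m i * x i - ∑ i, m i ^ 2 / 2))

theorem stdGaussianPi_map_add {ι : Type*} [Fintype ι] (m : ι → ℝ) :
    (stdGaussianPi ι).map (fun x i => x i + m i) =
      (stdGaussianPi ι).withDensity (shiftDensity m) := by
  unfold stdGaussianPi
  have h : ∀ i, (gaussianReal 0 1).map (fun x => x + m i) = (gaussianReal 0 1).withDensity
      fun x => ENNReal.ofReal (Real.exp (m i * x - m i ^ 2 / 2)) := fun i => by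
    rw [gaussianReal_map_add_const, zero_add, gaussianReal_shift_eq_withDensity]
  have (i : ι) : IsProbabilityMeasure ((gaussianReal 0 1).withDensity
      fun x => ENNReal.ofReal (Real.exp (m i * x - m i ^ 2 / 2))) := by
    rw [← gaussianReal_shift_eq_withDensity]; infer_instance
  have (i : ι) : SigmaFinite ((gaussianReal 0 1).map (fun x => x + m i)) := by
    rw [h]; infer_instance
  rw [Measure.pi_map_pi (f := fun i x => x + m i) (fun i => by fun_prop)]
  simp_rw [h]
  rw [pi_withDensity _ (fun i x => ENNReal.ofReal (Real.exp (m i * x - m i ^ 2 / 2)))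
    (fun i => by fun_prop)]
  congr 1
  ext x
  rw [shiftDensity, ← ENNReal.ofReal_prod_of_nonneg fun i _ => (Real.exp_pos _).le,
    ← Real.exp_sum, Finset.sum_sub_distrib]

theorem stdGaussianPi_map_scale {ι : Type*} [Fintype ι] {c : ℝ} (hc : 0 < c) :
    (stdGaussianPi ι).map (fun x i => c⁻¹ * x i) =
      (stdGaussianPi ι).withDensity fun x => ENNReal.ofReal
        (c ^ Fintype.card ι * Real.exp (-((c ^ 2 - 1) / 2 * ∑ i, x i ^ 2))) := by
  unfold stdGaussianPi
  have h := gaussianReal_scale_eq_withDensity hc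
  have : IsProbabilityMeasure ((gaussianReal 0 1).map (c⁻¹ * ·)) :=
    Measure.isProbabilityMeasure_map (by fun_prop)
  have : IsProbabilityMeasure ((gaussianReal 0 1).withDensity
      fun x => ENNReal.ofReal (c * Real.exp (-((c ^ 2 - 1) / 2 * x ^ 2)))) := by
    rw [← h]; infer_instance
  rw [Measure.pi_map_pi (f := fun _ x => c⁻¹ * x) (fun i => by fun_prop)]
  simp_rw [h]
  rw [pi_withDensity _ (fun _ x => ENNReal.ofReal (c * Real.exp (-((c ^ 2 - 1) / 2 * x ^ 2))))
    (fun i => by fun_prop)]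
  congr 1
  ext x
  rw [← ENNReal.ofReal_prod_of_nonneg fun i _ => by positivity, Finset.prod_mul_distrib,
    ← Real.exp_sum, Finset.prod_const, Finset.card_univ, Finset.sum_neg_distrib, Finset.mul_sum]

theorem lintegral_exp_inner_stdGaussianPi {ι : Type*} [Fintype ι] (m : ι → ℝ) :
    ∫⁻ x, ENNReal.ofReal (Real.exp (∑ i, m i * x i)) ∂stdGaussianPi ι =
      ENNReal.ofReal (Real.exp (∑ i, m i ^ 2 / 2)) := by
  have h1 : ∫⁻ x, shiftDensity m x ∂stdGaussianPi ι = 1 := by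
    have := congrArg (· Set.univ) (stdGaussianPi_map_add m)
    rw [← setLIntegral_univ, ← withDensity_apply _ MeasurableSet.univ, ← stdGaussianPi_map_add,
      Measure.map_apply (by fun_prop) MeasurableSet.univ]
    simp
  calc _ = ∫⁻ x, ENNReal.ofReal (Real.exp (∑ i, m i ^ 2 / 2)) * shiftDensity m x
        ∂stdGaussianPi ι := by
        congr 1
        ext x
        rw [shiftDensity, ← ENNReal.ofReal_mul (Real.exp_pos _).le, ← Real.exp_add]
        congr 2
        ring
    _ = _ := by
        rw [lintegral_const_mul' _ _ ENNReal.ofReal_ne_top, h1, mul_one]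

theorem lintegral_exp_mul_gaussianReal (m : ℝ) :
    ∫⁻ x, ENNReal.ofReal (Real.exp (m * x)) ∂gaussianReal 0 1 =
      ENNReal.ofReal (Real.exp (m ^ 2 / 2)) := by
  have h1 : ∫⁻ x, ENNReal.ofReal (Real.exp (m * x - m ^ 2 / 2)) ∂gaussianReal 0 1 = 1 := by
    rw [← setLIntegral_univ, ← withDensity_apply _ MeasurableSet.univ,
      ← gaussianReal_shift_eq_withDensity, measure_univ]
  calc _ = ∫⁻ x, ENNReal.ofReal (Real.exp (m ^ 2 / 2)) *
        ENNReal.ofReal (Real.exp (m * x - m ^ 2 / 2)) ∂gaussianReal 0 1 := by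
        congr 1
        ext x
        rw [← ENNReal.ofReal_mul (Real.exp_pos _).le, ← Real.exp_add]
        congr 2
        ring
    _ = _ := by
        rw [lintegral_const_mul' _ _ ENNReal.ofReal_ne_top, h1, mul_one]

/-- The exponential moment `E exp(λ² ξ² / 2)` of a standard Gaussian variable `ξ`. -/
def gaussianSqMoment (lam : ℝ) : ℝ≥0∞ :=
  ∫⁻ x, ENNReal.ofReal (Real.exp (lam ^ 2 * x ^ 2 / 2)) ∂gaussianReal 0 1

theorem gaussianSqMoment_ne_top {lam : ℝ} (hlam0 : 0 ≤ lam) (hlam : lam < 1) :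
    gaussianSqMoment lam ≠ ∞ := by
  have hb : 0 < (1 - lam ^ 2) / 2 := by nlinarith
  have hint := ((integrable_exp_neg_mul_sq hb).const_mul (√(2 * Real.pi))⁻¹).lintegral_lt_top
  rw [gaussianSqMoment, gaussianReal_of_var_ne_zero _ one_ne_zero,
    lintegral_withDensity_eq_lintegral_mul _ (measurable_gaussianPDF 0 1) (by fun_prop)]
  refine ne_of_eq_of_ne (lintegral_congr fun x => ?_) hint.ne
  rw [Pi.mul_apply, gaussianPDF, ← ENNReal.ofReal_mul (gaussianPDFReal_nonneg _ _ _),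
    gaussianPDFReal, mul_assoc, ← Real.exp_add]
  simp only [NNReal.coe_one, mul_one, sub_zero]
  congr 3
  ring

theorem lintegral_exp_inner_sq_le {ι : Type*} [Fintype ι] (lam : ℝ) {w : ι → ℝ}
    (hw : ∑ i, w i ^ 2 ≤ 1) :
    ∫⁻ x, ENNReal.ofReal (Real.exp (lam ^ 2 * (∑ i, w i * x i) ^ 2 / 2)) ∂stdGaussianPi ι ≤
      gaussianSqMoment lam := by
  have hlin (x : ι → ℝ) : ENNReal.ofReal (Real.exp (lam ^ 2 * (∑ i, w i * x i) ^ 2 / 2)) =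
      ∫⁻ ξ, ENNReal.ofReal (Real.exp (∑ i, (lam * ξ * w i) * x i)) ∂gaussianReal 0 1 := by
    rw [← mul_pow, ← lintegral_exp_mul_gaussianReal]
    refine lintegral_congr fun ξ => ?_
    congr 2
    rw [Finset.mul_sum, Finset.sum_mul]
    exact Finset.sum_congr rfl fun i _ => by ring
  simp_rw [hlin]
  rw [lintegral_lintegral_swap (by fun_prop)]
  refine lintegral_mono fun ξ => ?_
  rw [lintegral_exp_inner_stdGaussianPi]
  refine ENNReal.ofReal_le_ofReal (Real.exp_le_exp.2 ?_)
  have : ∑ i, (lam * ξ * w i) ^ 2 / 2 = lam ^ 2 * ξ ^ 2 / 2 * ∑ i, w i ^ 2 := by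
    rw [Finset.mul_sum]
    exact Finset.sum_congr rfl fun i _ => by ring
  rw [this]
  exact mul_le_of_le_one_right (by positivity) hw

theorem lintegral_eq_scaled_of_homogeneous {ι : Type*} [Fintype ι] {h : (ι → ℝ) → ℝ≥0∞}
    (hm : Measurable h) (hh : ∀ c : ℝ, 0 < c → ∀ x, h (fun i => c * x i) = h x)
    {c : ℝ} (hc : 0 < c) :
    ∫⁻ x, h x ∂stdGaussianPi ι = ∫⁻ x, ENNReal.ofReal
      (c ^ Fintype.card ι * Real.exp (-((c ^ 2 - 1) / 2 * ∑ i, x i ^ 2))) * h x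
        ∂stdGaussianPi ι := by
  have h1 : ∫⁻ x, h x ∂(stdGaussianPi ι).map (fun x i => c⁻¹ * x i) =
      ∫⁻ x, h x ∂stdGaussianPi ι := by
    rw [lintegral_map hm (by fun_prop)]
    exact lintegral_congr fun x => hh _ (inv_pos.2 hc) x
  rw [← h1, stdGaussianPi_map_scale hc,
    lintegral_withDensity_eq_lintegral_mul _ (by fun_prop) hm]
  rfl

theorem card_mul_lintegral_le_of_homogeneous {ι : Type*} [Fintype ι] {h : (ι → ℝ) → ℝ≥0∞}
    (hm : Measurable h) (hh : ∀ c : ℝ, 0 < c → ∀ x, h (fun i => c * x i) = h x)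
    (hfin : ∫⁻ x, h x ∂stdGaussianPi ι ≠ ∞) :
    Fintype.card ι * ∫⁻ x, h x ∂stdGaussianPi ι ≤
      ∫⁻ x, h x * ENNReal.ofReal (∑ i, x i ^ 2) ∂stdGaussianPi ι := by
  set N := Fintype.card ι with hN
  set I := ∫⁻ x, h x ∂stdGaussianPi ι with hI
  set J := ∫⁻ x, h x * ENNReal.ofReal (∑ i, x i ^ 2) ∂stdGaussianPi ι with hJ
  by_cases hJtop : J = ∞
  · rw [hJtop]; exact le_top
  have hscale (ε : ℝ) (hε : 0 < ε) :
      N * I.toReal ≤ (1 + ε) ^ N * (1 + ε / 2) * J.toReal := by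
    have hc : 0 < 1 + ε := by linarith
    set τ := ((1 + ε) ^ 2 - 1) / 2 with hτ
    have hτ0 : 0 ≤ τ := by nlinarith
    have hle : ENNReal.ofReal ((1 + ε) ^ N) * I ≤ I + ENNReal.ofReal ((1 + ε) ^ N * τ) * J := by
      conv_rhs => rw [hI, lintegral_eq_scaled_of_homogeneous hm hh hc]
      rw [hI, hJ, ← lintegral_const_mul' _ _ ENNReal.ofReal_ne_top,
        ← lintegral_const_mul' _ _ ENNReal.ofReal_ne_top, ← lintegral_add_left (by fun_prop)]
      refine lintegral_mono fun x => ?_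
      have hR : 0 ≤ ∑ i, x i ^ 2 := by positivity
      have e : ENNReal.ofReal ((1 + ε) ^ N * τ) * (h x * ENNReal.ofReal (∑ i, x i ^ 2)) =
          ENNReal.ofReal ((1 + ε) ^ N * τ * ∑ i, x i ^ 2) * h x := by
        rw [ENNReal.ofReal_mul (p := (1 + ε) ^ N * τ) (by positivity)]
        ring
      simp only
      rw [e, ← add_mul, ← ENNReal.ofReal_add (by positivity) (by positivity)]
      gcongr
      have := Real.add_one_le_exp (-(τ * ∑ i, x i ^ 2))
      calc (1 + ε) ^ N = (1 + ε) ^ N * ((-(τ * ∑ i, x i ^ 2) + 1) + τ * ∑ i, x i ^ 2) := by ring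
        _ ≤ (1 + ε) ^ N * (Real.exp (-(τ * ∑ i, x i ^ 2)) + τ * ∑ i, x i ^ 2) := by gcongr
        _ = _ := by ring
    have hreal : (1 + ε) ^ N * I.toReal ≤ I.toReal + (1 + ε) ^ N * τ * J.toReal := by
      have := ENNReal.toReal_mono (by finiteness) hle
      rwa [ENNReal.toReal_add hfin (by finiteness), ENNReal.toReal_mul, ENNReal.toReal_mul,
        ENNReal.toReal_ofReal (by positivity), ENNReal.toReal_ofReal (by positivity)] at this
    have hbern := one_add_mul_le_pow (by linarith : -2 ≤ ε) N
    have hI0 : 0 ≤ I.toReal := ENNReal.toReal_nonneg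
    have hmul : ε * (N * I.toReal) ≤ ε * ((1 + ε) ^ N * (1 + ε / 2) * J.toReal) := by
      have e : (1 + ε) ^ N * τ * J.toReal = ε * ((1 + ε) ^ N * (1 + ε / 2) * J.toReal) := by
        rw [hτ]; ring
      nlinarith [mul_le_mul_of_nonneg_right hbern hI0]
    exact le_of_mul_le_mul_left hmul hε
  have hlim : Tendsto (fun ε : ℝ => (1 + ε) ^ N * (1 + ε / 2) * J.toReal)
      (nhdsWithin 0 (Set.Ioi 0)) (nhds J.toReal) := by
    have : Continuous fun ε : ℝ => (1 + ε) ^ N * (1 + ε / 2) * J.toReal := by fun_prop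
    simpa using (this.tendsto 0).mono_left nhdsWithin_le_nhds
  have hfinal : N * I.toReal ≤ J.toReal :=
    ge_of_tendsto hlim (eventually_nhdsWithin_of_forall fun ε hε => hscale ε hε)
  rw [← ENNReal.toReal_le_toReal (by finiteness) hJtop, ENNReal.toReal_mul,
    ENNReal.toReal_natCast]
  exact hfinal

theorem lintegral_exp_normalized_inner_sq_le {ι : Type*} [Fintype ι] (lam : ℝ) {w : ι → ℝ}
    (hw : ∑ i, w i ^ 2 ≤ 1) :
    ∫⁻ x, ENNReal.ofReal (Real.exp (Fintype.card ι *
        (lam ^ 2 * ((∑ i, w i * x i) ^ 2 / ∑ i, x i ^ 2) / 2))) ∂stdGaussianPi ι ≤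
      gaussianSqMoment lam := by
  set N := Fintype.card ι with hN
  set u : (ι → ℝ) → ℝ := fun x => lam ^ 2 * ((∑ i, w i * x i) ^ 2 / ∑ i, x i ^ 2) / 2 with hu
  have hum : Measurable u := by fun_prop
  have hu0 (x) : 0 ≤ u x := by positivity
  have hcs (x : ι → ℝ) : (∑ i, w i * x i) ^ 2 ≤ ∑ i, x i ^ 2 :=
    (Finset.sum_mul_sq_le_sq_mul_sq _ _ _).trans (mul_le_of_le_one_left (by positivity) hw)
  have hu1 (x) : u x ≤ lam ^ 2 / 2 := by
    have : (∑ i, w i * x i) ^ 2 / ∑ i, x i ^ 2 ≤ 1 := div_le_one_of_le₀ (hcs x) (by positivity)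
    have := mul_le_of_le_one_right (sq_nonneg lam) this
    simp only [hu]
    linarith
  have huR (x) : u x * ∑ i, x i ^ 2 = lam ^ 2 * (∑ i, w i * x i) ^ 2 / 2 := by
    have : (∑ i, w i * x i) ^ 2 / (∑ i, x i ^ 2) * ∑ i, x i ^ 2 = (∑ i, w i * x i) ^ 2 :=
      div_mul_cancel_of_imp fun h0 => le_antisymm (h0 ▸ hcs x) (sq_nonneg _)
    rw [← this]
    simp only [hu]
    ring
  have huh (c : ℝ) (hc : 0 < c) (x : ι → ℝ) : u (fun i => c * x i) = u x := by
    have h1 : ∑ i, w i * (c * x i) = c * ∑ i, w i * x i := by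
      rw [Finset.mul_sum]
      exact Finset.sum_congr rfl fun i _ => by ring
    have h2 : ∑ i, (c * x i) ^ 2 = c ^ 2 * ∑ i, x i ^ 2 := by
      rw [Finset.mul_sum]
      exact Finset.sum_congr rfl fun i _ => by ring
    simp only [hu]
    rw [h1, h2, mul_pow, mul_div_mul_left _ _ (by positivity)]
  set G : (ι → ℝ) → ℝ≥0∞ := fun x => ENNReal.ofReal (Real.exp (N * u x) * u x) with hG
  have hGm : Measurable G := by fun_prop
  have hGfin : ∫⁻ x, G x ∂stdGaussianPi ι ≠ ∞ := by
    refine ((lintegral_mono (g := fun _ => ENNReal.ofReal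
      (Real.exp (N * (lam ^ 2 / 2)) * (lam ^ 2 / 2))) fun x => ?_).trans_lt ?_).ne
    · refine ENNReal.ofReal_le_ofReal ?_
      have := hu1 x
      have := hu0 x
      gcongr
    · simp
  have hstein := card_mul_lintegral_le_of_homogeneous hGm
    (fun c hc x => by simp only [hG]; rw [huh c hc]) hGfin
  have htangent : ∫⁻ x, ENNReal.ofReal (Real.exp (N * u x)) ∂stdGaussianPi ι +
      ∫⁻ x, G x * ENNReal.ofReal (∑ i, x i ^ 2) ∂stdGaussianPi ι ≤
      ∫⁻ x, ENNReal.ofReal (Real.exp (lam ^ 2 * (∑ i, w i * x i) ^ 2 / 2)) ∂stdGaussianPi ι +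
        N * ∫⁻ x, G x ∂stdGaussianPi ι := by
    rw [← lintegral_const_mul' _ _ (by finiteness), ← lintegral_add_left (by fun_prop),
      ← lintegral_add_left (by fun_prop)]
    refine lintegral_mono fun x => ?_
    have hux := hu0 x
    simp only [hG]
    rw [← ENNReal.ofReal_mul (by positivity), ← ENNReal.ofReal_add (by positivity) (by positivity),
      ← ENNReal.ofReal_natCast, ← ENNReal.ofReal_mul (by positivity),
      ← ENNReal.ofReal_add (by positivity) (by positivity), ← huR]
    refine ENNReal.ofReal_le_ofReal ?_
    have h1 := Real.add_one_le_exp (u x * ∑ i, x i ^ 2 - N * u x)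
    have h2 : Real.exp (u x * ∑ i, x i ^ 2) =
        Real.exp (N * u x) * Real.exp (u x * ∑ i, x i ^ 2 - N * u x) := by
      rw [← Real.exp_add]
      congr 1
      ring
    rw [h2]
    nlinarith [mul_le_mul_of_nonneg_left h1 (Real.exp_pos (N * u x)).le]
  have hcancel := (add_le_add_right hstein _).trans htangent
  refine le_trans ?_ (lintegral_exp_inner_sq_le lam hw)
  exact (ENNReal.add_le_add_iff_right (by finiteness)).1 hcancel

theorem measurable_shiftDensity {Ω ι : Type*} [MeasurableSpace Ω] [Fintype ι]
    {m : Ω → ι → ℝ} (hm : Measurable m) :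
    Measurable fun q : Ω × (ι → ℝ) => shiftDensity (m q.1) q.2 := by
  unfold shiftDensity
  fun_prop

theorem lintegral_shiftDensity_mul {ι : Type*} [Fintype ι] (a b : ι → ℝ) :
    ∫⁻ x, shiftDensity a x * shiftDensity b x ∂stdGaussianPi ι =
      ENNReal.ofReal (Real.exp (∑ i, a i * b i)) := by
  have h (x : ι → ℝ) : shiftDensity a x * shiftDensity b x =
      ENNReal.ofReal (Real.exp (-∑ i, (a i ^ 2 / 2 + b i ^ 2 / 2))) *
        ENNReal.ofReal (Real.exp (∑ i, (a i + b i) * x i)) := by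
    rw [shiftDensity, shiftDensity, ← ENNReal.ofReal_mul (Real.exp_pos _).le,
      ← ENNReal.ofReal_mul (Real.exp_pos _).le, ← Real.exp_add, ← Real.exp_add]
    congr 2
    simp only [add_mul, Finset.sum_add_distrib]
    ring
  simp_rw [h]
  rw [lintegral_const_mul' _ _ ENNReal.ofReal_ne_top, lintegral_exp_inner_stdGaussianPi,
    ← ENNReal.ofReal_mul (Real.exp_pos _).le, ← Real.exp_add, ← Finset.sum_neg_distrib,
    ← Finset.sum_add_distrib]
  congr 2
  exact Finset.sum_congr rfl fun i _ => by ring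

/-- The second moment method for mixtures of shifted Gaussian measures. -/
theorem lintegral_stdGaussianPi_shift_le {Ω ι : Type*} [MeasurableSpace Ω] [Fintype ι]
    (ρ : Measure Ω) [SFinite ρ] {m : Ω → ι → ℝ} (hm : Measurable m)
    {B : Set (ι → ℝ)} (hB : MeasurableSet B) :
    ∫⁻ p, stdGaussianPi ι {x | (fun i => x i + m p i) ∈ B} ∂ρ ≤
      (stdGaussianPi ι B) ^ (1 / 2 : ℝ) *
        (∫⁻ p, ∫⁻ q, ENNReal.ofReal (Real.exp (∑ i, m p i * m q i)) ∂ρ ∂ρ) ^ (1 / 2 : ℝ) := by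
  have hmeas := measurable_shiftDensity hm
  have hmeas' (x : ι → ℝ) : Measurable fun p => shiftDensity (m p) x := by
    unfold shiftDensity
    fun_prop
  set L : (ι → ℝ) → ℝ≥0∞ := fun x => ∫⁻ p, shiftDensity (m p) x ∂ρ with hL
  have hLm : Measurable L := hmeas.lintegral_prod_left'
  have hfirst : ∫⁻ p, stdGaussianPi ι {x | (fun i => x i + m p i) ∈ B} ∂ρ =
      ∫⁻ x, ((B.indicator 1 : (ι → ℝ) → ℝ≥0∞) * L) x ∂stdGaussianPi ι := by
    have h1 (p : Ω) : stdGaussianPi ι {x | (fun i => x i + m p i) ∈ B} =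
        ∫⁻ x in B, shiftDensity (m p) x ∂stdGaussianPi ι := by
      rw [← withDensity_apply _ hB, ← stdGaussianPi_map_add,
        Measure.map_apply (by fun_prop) hB]
      rfl
    simp_rw [h1]
    rw [lintegral_lintegral_swap (by exact hmeas.aemeasurable), ← lintegral_indicator hB]
    refine lintegral_congr fun x => ?_
    by_cases hx : x ∈ B <;> simp [hx, hL]
  have hsecond : ∫⁻ x, L x ^ (2 : ℝ) ∂stdGaussianPi ι =
      ∫⁻ p, ∫⁻ q, ENNReal.ofReal (Real.exp (∑ i, m p i * m q i)) ∂ρ ∂ρ := by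
    have h1 (x : ι → ℝ) : L x ^ (2 : ℝ) =
        ∫⁻ p, ∫⁻ q, shiftDensity (m p) x * shiftDensity (m q) x ∂ρ ∂ρ := by
      rw [ENNReal.rpow_two, sq]
      simp_rw [lintegral_const_mul _ (hmeas' x)]
      rw [lintegral_mul_const _ (hmeas' x)]
    have h2 : Measurable fun z : ((ι → ℝ) × Ω) × Ω =>
        shiftDensity (m z.1.2) z.1.1 * shiftDensity (m z.2) z.1.1 := by
      unfold shiftDensity
      fun_prop
    simp_rw [h1]
    refine (lintegral_lintegral_swap
      (f := fun x p => ∫⁻ q, shiftDensity (m p) x * shiftDensity (m q) x ∂ρ)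
      (Measurable.lintegral_prod_right' h2).aemeasurable).trans (lintegral_congr fun p => ?_)
    refine (lintegral_lintegral_swap
      (f := fun x q => shiftDensity (m p) x * shiftDensity (m q) x)
      (Measurable.aemeasurable ?_)).trans
      (lintegral_congr fun q => lintegral_shiftDensity_mul (m p) (m q))
    unfold shiftDensity
    fun_prop
  have hind : ∫⁻ x, B.indicator (1 : (ι → ℝ) → ℝ≥0∞) x ^ (2 : ℝ) ∂stdGaussianPi ι =
      stdGaussianPi ι B := by
    rw [← lintegral_indicator_one hB]
    refine lintegral_congr fun x => ?_
    by_cases hx : x ∈ B <;> simp [hx]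
  rw [hfirst, ← hsecond, ← hind]
  exact ENNReal.lintegral_mul_le_Lp_mul_Lq _ Real.HolderConjugate.two_two
    ((measurable_one.indicator hB).aemeasurable) hLm.aemeasurable

instance isProbabilityMeasure_sphereUniform (n : ℕ) :
    IsProbabilityMeasure (sphereUniform n) := by
  unfold sphereUniform
  have := Measure.isProbabilityMeasure_map (μ := stdGaussianPi (Fin n))
    (f := fun x => ((EuclideanSpace.equiv (Fin n) ℝ).symm x : EuclideanSpace ℝ (Fin n)))
    (by fun_prop)
  exact Measure.isProbabilityMeasure_map (by fun_prop)

instance isProbabilityMeasure_ginibre (n : ℕ) : IsProbabilityMeasure (ginibre n) :=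
  Measure.isProbabilityMeasure_map
    (measurable_pi_lambda _ fun i => measurable_pi_lambda _ fun j => by
      simp only [Matrix.of_apply]; fun_prop).aemeasurable

theorem ae_sphereUniform_sum_sq_le_one (n : ℕ) :
    ∀ᵐ v ∂sphereUniform n, ∑ i, v i ^ 2 ≤ 1 := by
  unfold sphereUniform
  rw [ae_map_iff (by fun_prop) (measurableSet_le (by fun_prop) (by fun_prop))]
  refine Eventually.of_forall fun v => ?_
  rw [← EuclideanSpace.real_norm_sq_eq, norm_smul, norm_inv, norm_norm]
  exact pow_le_one₀ (by positivity) (inv_mul_le_one_of_le₀ le_rfl (norm_nonneg _))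

theorem lintegral_sphereUniform_exp_le (n : ℕ) (lam : ℝ) {w : EuclideanSpace ℝ (Fin n)}
    (hw : ∑ i, w i ^ 2 ≤ 1) :
    ∫⁻ v, ENNReal.ofReal (Real.exp (n * (lam ^ 2 * (∑ i, w i * v i) ^ 2 / 2)))
      ∂sphereUniform n ≤ gaussianSqMoment lam := by
  refine le_of_eq_of_le ?_ (lintegral_exp_normalized_inner_sq_le lam hw)
  unfold sphereUniform
  rw [lintegral_map (by fun_prop) (by fun_prop), lintegral_map (by fun_prop) (by fun_prop)]
  refine lintegral_congr fun x => ?_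
  set y : EuclideanSpace ℝ (Fin n) := (EuclideanSpace.equiv (Fin n) ℝ).symm x with hy
  have hyx (i) : y i = x i := rfl
  have h1 : ∑ i, w i * (‖y‖⁻¹ • y) i = ‖y‖⁻¹ * ∑ i, w i * x i := by
    rw [Finset.mul_sum]
    refine Finset.sum_congr rfl fun i _ => ?_
    rw [PiLp.smul_apply, smul_eq_mul, hyx]
    ring
  have h2 : ‖y‖ ^ 2 = ∑ i, x i ^ 2 := EuclideanSpace.real_norm_sq_eq y
  rw [h1, mul_pow, inv_pow, h2, Fintype.card_fin, div_eq_inv_mul _ (∑ i, x i ^ 2)]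

theorem lintegral_exp_rank_one_overlap_le (n : ℕ) (lam : ℝ) :
    ∫⁻ p, ∫⁻ q, ENNReal.ofReal (Real.exp (∑ k : Fin n × Fin n,
        (√n * (lam * (p.1 k.1 * p.2 k.2))) * (√n * (lam * (q.1 k.1 * q.2 k.2)))))
      ∂(sphereUniform n).prod (sphereUniform n) ∂(sphereUniform n).prod (sphereUniform n) ≤
      gaussianSqMoment lam * gaussianSqMoment lam := by
  have hae : ∀ᵐ p ∂(sphereUniform n).prod (sphereUniform n),
      ∑ i, p.1 i ^ 2 ≤ 1 ∧ ∑ i, p.2 i ^ 2 ≤ 1 :=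
    (Measure.quasiMeasurePreserving_fst.ae (ae_sphereUniform_sum_sq_le_one n)).and
      (Measure.quasiMeasurePreserving_snd.ae (ae_sphereUniform_sum_sq_le_one n))
  refine (lintegral_mono_ae (g := fun _ => gaussianSqMoment lam * gaussianSqMoment lam)
    (hae.mono fun p hp => ?_)).trans (by simp)
  refine (lintegral_mono fun q => ?_).trans ((lintegral_prod_mul
    (f := fun v : EuclideanSpace ℝ (Fin n) =>
      ENNReal.ofReal (Real.exp (n * (lam ^ 2 * (∑ i, p.1 i * v i) ^ 2 / 2))))
    (g := fun v : EuclideanSpace ℝ (Fin n) =>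
      ENNReal.ofReal (Real.exp (n * (lam ^ 2 * (∑ i, p.2 i * v i) ^ 2 / 2))))
    (by fun_prop) (by fun_prop)).trans_le ?_)
  · rw [← ENNReal.ofReal_mul (Real.exp_pos _).le, ← Real.exp_add]
    refine ENNReal.ofReal_le_ofReal (Real.exp_le_exp.2 ?_)
    have hsum : ∑ k : Fin n × Fin n,
        (√n * (lam * (p.1 k.1 * p.2 k.2))) * (√n * (lam * (q.1 k.1 * q.2 k.2))) =
        n * lam ^ 2 * ((∑ i, p.1 i * q.1 i) * ∑ j, p.2 j * q.2 j) := by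
      rw [Finset.sum_mul_sum, Fintype.sum_prod_type, Finset.mul_sum]
      refine Finset.sum_congr rfl fun i _ => ?_
      rw [Finset.mul_sum]
      refine Finset.sum_congr rfl fun j _ => ?_
      rw [mul_mul_mul_comm, Real.mul_self_sqrt (Nat.cast_nonneg n)]
      ring
    rw [hsum]
    have h0 : (0 : ℝ) ≤ n * lam ^ 2 := by positivity
    nlinarith [mul_nonneg h0 (sq_nonneg ((∑ i, p.1 i * q.1 i) - ∑ j, p.2 j * q.2 j))]
  · exact mul_le_mul' (lintegral_sphereUniform_exp_le n lam hp.1)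
      (lintegral_sphereUniform_exp_le n lam hp.2)

theorem spikedGinibre_le {n : ℕ} (hn : n ≠ 0) (lam : ℝ) {A : Set (Matrix (Fin n) (Fin n) ℝ)}
    (hA : MeasurableSet A) :
    spikedGinibre n lam A ≤ (ginibre n A) ^ (1 / 2 : ℝ) *
      (gaussianSqMoment lam * gaussianSqMoment lam) ^ (1 / 2 : ℝ) := by
  have hsqrt : √(n : ℝ) ≠ 0 := by positivity
  have hentry (i j : Fin n) : Measurable fun M : Matrix (Fin n) (Fin n) ℝ => M i j :=
    (measurable_pi_apply j).comp (measurable_pi_apply i)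
  have hscale : Measurable fun g : Fin n × Fin n → ℝ =>
      (Matrix.of fun i j => g (i, j) / √n : Matrix (Fin n) (Fin n) ℝ) :=
    measurable_pi_lambda _ fun i => measurable_pi_lambda _ fun j => by
      simp only [Matrix.of_apply]; fun_prop
  have hspike : Measurable fun p : (EuclideanSpace ℝ (Fin n) × EuclideanSpace ℝ (Fin n)) ×
      Matrix (Fin n) (Fin n) ℝ => (Matrix.of fun i j =>
        lam * (p.1.1 i * p.1.2 j) + p.2 i j : Matrix (Fin n) (Fin n) ℝ) :=
    measurable_pi_lambda _ fun i => measurable_pi_lambda _ fun j => by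
      simp only [Matrix.of_apply]
      exact Measurable.add (by fun_prop) ((hentry i j).comp measurable_snd)
  have hmain := lintegral_stdGaussianPi_shift_le ((sphereUniform n).prod (sphereUniform n))
    (m := fun p (k : Fin n × Fin n) => √n * (lam * (p.1 k.1 * p.2 k.2))) (by fun_prop)
    (hscale hA)
  have hlhs : spikedGinibre n lam A =
      ∫⁻ p, stdGaussianPi (Fin n × Fin n) {x | (fun k => x k + √n * (lam * (p.1 k.1 * p.2 k.2))) ∈
        (fun g : Fin n × Fin n → ℝ =>
          (Matrix.of fun i j => g (i, j) / √n : Matrix (Fin n) (Fin n) ℝ)) ⁻¹' A}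
        ∂(sphereUniform n).prod (sphereUniform n) := by
    rw [spikedGinibre, Measure.map_apply hspike hA, Measure.prod_apply (hspike hA)]
    refine lintegral_congr fun p => ?_
    rw [ginibre, Measure.map_apply hscale (measurable_prodMk_left (hspike hA))]
    congr 1
    ext x
    simp only [Set.mem_preimage, Set.mem_ofPred_eq]
    refine iff_of_eq (congrArg (· ∈ A) ?_)
    ext i j
    simp only [Matrix.of_apply]
    field_simp
    ring
  have hrhs : ginibre n A = stdGaussianPi (Fin n × Fin n) ((fun g : Fin n × Fin n → ℝ =>
      (Matrix.of fun i j => g (i, j) / √n : Matrix (Fin n) (Fin n) ℝ)) ⁻¹' A) :=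
    Measure.map_apply hscale hA
  rw [hlhs, hrhs]
  refine hmain.trans ?_
  gcongr
  exact lintegral_exp_rank_one_overlap_le n lam

/-- for `k = 2` and `0 ≤ λ < 1`, the laws of `λ v₁ v₂ᵀ + Z` are contiguous with
respect to the laws of `Z`. -/
theorem spiked_ginibre_contiguous
    (lam : ℝ) (hlam0 : 0 ≤ lam) (hlam : lam < 1)
    (A : ∀ n, Set (Matrix (Fin n) (Fin n) ℝ)) (hA : ∀ n, MeasurableSet (A n))
    (h0 : Tendsto (fun n => ginibre n (A n)) atTop (nhds 0)) :
    Tendsto (fun n => spikedGinibre n lam (A n)) atTop (nhds 0) := by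
  have hC : (gaussianSqMoment lam * gaussianSqMoment lam) ^ (1 / 2 : ℝ) ≠ ∞ :=
    ENNReal.rpow_ne_top_of_nonneg (by norm_num)
      (ENNReal.mul_ne_top (gaussianSqMoment_ne_top hlam0 hlam) (gaussianSqMoment_ne_top hlam0 hlam))
  have hbound : Tendsto (fun n => (ginibre n (A n)) ^ (1 / 2 : ℝ) *
      (gaussianSqMoment lam * gaussianSqMoment lam) ^ (1 / 2 : ℝ)) atTop (nhds 0) := by
    have h1 := (ENNReal.continuous_rpow_const (y := 1 / 2)).tendsto 0 |>.comp h0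
    rw [ENNReal.zero_rpow_of_pos (by norm_num)] at h1
    simpa using ENNReal.Tendsto.mul_const h1 (Or.inr hC)
  exact tendsto_of_tendsto_of_tendsto_of_le_of_le' tendsto_const_nhds hbound
    (Eventually.of_forall fun _ => zero_le)
    ((eventually_ne_atTop 0).mono fun n hn => spikedGinibre_le hn lam (hA n))

end
end
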